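/- Backward annotation transitions of distinct processes have independent read/write sets: suppose A' ⇀(p_a, Rd_a, Wt_a) A and A'' ⇀(p_b, Rd_b, Wt_b) A are two backward annotation transitions enabled at the same annotation DAG A (i.e., both forward transitions end at A), and p_a ≠ p_b. Then Rd_a ∩ Wt_b = ∅ and Rd_b ∩ Wt_a = ∅. -/

import Mathlib

namespace CRIL

/-- Process identifiers: finite lists of positive integers. -/
abbrev PID := List ℕ+

/-- Nodes of an annotation DAG: either ⊥ or a pair (p, n). -/
inductive ANode where
  | bot : ANode
  | node : PID → ℕ → ANode
deriving DecidableEq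

/-- Labeled edges. -/
abbrev AEdge (R : Type) := ANode × R × ANode

/-- Annotation DAGs, with the five defining conditions. -/
structure AnnDAG (R : Type) where
  V : Set ANode
  ER : Set (AEdge R)
  EW : Set (AEdge R)
  finV : V.Finite
  bot_mem : ANode.bot ∈ V
  down : ∀ p n, ANode.node p n ∈ V → ∀ n' ≤ n, ANode.node p n' ∈ V
  edges_sub : ∀ e ∈ ER ∪ EW, e.1 ∈ V ∧ e.2.2 ∈ V
  in_unique : ∀ v' v'' r v, (v', r, v) ∈ ER ∪ EW → (v'', r, v) ∈ ER ∪ EW → v' = v''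
  disj : ER ∩ EW = ∅
  acyclic : ∀ v, ¬ Relation.TransGen (fun a b => ∃ r, (a, r, b) ∈ ER ∪ EW) v v
  w_pred : ∀ v' r v, (v', r, v) ∈ EW → v' ≠ ANode.bot → ∃ v'', (v'', r, v') ∈ EW
  w_out_unique : ∀ v r v' v'', (v, r, v') ∈ EW → (v, r, v'') ∈ EW → v' = v''

-- `last(r, E_W)`: the final node of the unique maximal chain of `r`-labeled
-- `E_W`-edges starting at ⊥ (⊥ if there is no such edge).
open Classical in
noncomputable def lastN {R : Type} (EW : Set (AEdge R)) (r : R) : ANode :=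
  if h : ∃! v, Relation.ReflTransGen (fun a b => (a, r, b) ∈ EW) ANode.bot v ∧
      ∀ w, (v, r, w) ∉ EW
  then h.exists.choose
  else ANode.bot

/-- `max_p(V) + 1`: one plus the largest `n` with `(p,n) ∈ V` (0 if none). -/
noncomputable def maxpSucc (V : Set ANode) (p : PID) : ℕ :=
  sSup {m : ℕ | ∃ n, m = n + 1 ∧ ANode.node p n ∈ V}

/-- `max_p(V)` as an integer, −1 if no `(p,n) ∈ V`. -/
noncomputable def maxp (V : Set ANode) (p : PID) : ℤ :=
  (maxpSucc V p : ℤ) - 1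

/-- Labels (p, Rd, Wt). -/
abbrev Label (R : Type) := PID × Set R × Set R

/-- Forward annotation transition A₁ ⇀(p,Rd,Wt) A₂. -/
def Step {R : Type} (A₁ A₂ : AnnDAG R) (p : PID) (Rd Wt : Set R) : Prop :=
  A₂.V = A₁.V ∪ {ANode.node p (maxpSucc A₁.V p)} ∧
  A₂.ER = A₁.ER ∪
    {e | ∃ r ∈ Rd \ Wt, e = (lastN A₁.EW r, r, ANode.node p (maxpSucc A₁.V p))} ∧
  A₂.EW = A₁.EW ∪
    {e | ∃ r ∈ Wt, e = (lastN A₁.EW r, r, ANode.node p (maxpSucc A₁.V p))}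

/-- Forward transition with some label. -/
def StepAny {R : Type} (A₁ A₂ : AnnDAG R) : Prop := ∃ p Rd Wt, Step A₁ A₂ p Rd Wt

/-- Forward transition with some label in `O`. -/
def StepIn {R : Type} (O : Set (Label R)) (A₁ A₂ : AnnDAG R) : Prop :=
  ∃ l ∈ O, Step A₁ A₂ l.1 l.2.1 l.2.2

/-- The initial annotation DAG ({⊥}, ∅, ∅). -/
def Ainit (R : Type) : AnnDAG R where
  V := {ANode.bot}
  ER := ∅
  EW := ∅
  finV := Set.finite_singleton _
  bot_mem := rfl
  down := by intro p n h; simp at h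
  edges_sub := by intro e he; simp at he
  in_unique := by intro v' v'' r v h; simp at h
  disj := by simp
  acyclic := by
    intro v h
    have hne : ∀ a b : ANode, ¬ ∃ r : R, (a, r, b) ∈ (∅ ∪ ∅ : Set (AEdge R)) := by simp
    cases h with
    | single h' => exact hne _ _ h'
    | tail _ h' => exact hne _ _ h'
  w_pred := by intro v' r v h; simp at h
  w_out_unique := by intro v r v' v'' h; simp at h

/-- Signed labels: forward or underlined (backward). -/
inductive SLabel (R : Type) where
  | fwd : Label R → SLabel R
  | bwd : Label R → SLabel R

/-- `und`: forget the underline. -/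
def und {R : Type} : SLabel R → Label R
  | .fwd a => a
  | .bwd a => a

/-- The underline-toggle. -/
def toggle {R : Type} : SLabel R → SLabel R
  | .fwd a => .bwd a
  | .bwd a => .fwd a

/-- Combined transitions: forward, or reversed forward. -/
def CStep {R : Type} (A A' : AnnDAG R) : SLabel R → Prop
  | .fwd a => Step A A' a.1 a.2.1 a.2.2
  | .bwd a => Step A' A a.1 a.2.1 a.2.2

/-- Independence of signed labels: incomparable pids and disjoint read/write sets. -/
def indepLab {R : Type} (α β : SLabel R) : Prop :=
  ¬ (und α).1 <+: (und β).1 ∧ ¬ (und β).1 <+: (und α).1 ∧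
  (und α).2.1 ∩ (und β).2.2 = ∅ ∧ (und β).2.1 ∩ (und α).2.2 = ∅

/-- `diff` of a combined transition. -/
def diff {R : Type} (A A' : AnnDAG R) (α : SLabel R) :
    Set ANode × Set (AEdge R) × Set (AEdge R) :=
  match α with
  | .fwd _ => (A'.V \ A.V, A'.ER \ A.ER, A'.EW \ A.EW)
  | .bwd _ => (A.V \ A'.V, A.ER \ A'.ER, A.EW \ A'.EW)

/-- The underlying triple of an annotation DAG. -/
def triple {R : Type} (A : AnnDAG R) : Set ANode × Set (AEdge R) × Set (AEdge R) :=
  (A.V, A.ER, A.EW)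

/-- The ⊙^α operation on triples. -/
def odot {R : Type} (α : SLabel R)
    (T Δ : Set ANode × Set (AEdge R) × Set (AEdge R)) :
    Set ANode × Set (AEdge R) × Set (AEdge R) :=
  match α with
  | .fwd _ => (T.1 ∪ Δ.1, T.2.1 ∪ Δ.2.1, T.2.2 ∪ Δ.2.2)
  | .bwd _ => (T.1 \ Δ.1, T.2.1 \ Δ.2.1, T.2.2 \ Δ.2.2)


/-- Every target of an `r`-labeled write edge lies on the `r`-labeled write chain from `⊥`. -/
theorem AnnDAG.reflTransGen_bot {R : Type} (A : AnnDAG R) {r : R} {u v : ANode}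
    (h : (u, r, v) ∈ A.EW) :
    Relation.ReflTransGen (fun a b => (a, r, b) ∈ A.EW) ANode.bot v := by
  have : IsStrictOrder ANode
      (Relation.TransGen fun a b => ∃ r, (a, r, b) ∈ A.ER ∪ A.EW) :=
    { irrefl := A.acyclic, trans := fun _ _ _ => Relation.TransGen.trans }
  have hwf : A.V.WellFoundedOn
      (Relation.TransGen fun a b => ∃ r, (a, r, b) ∈ A.ER ∪ A.EW) :=
    Set.Finite.wellFoundedOn A.finV
  refine hwf.induction (A.edges_sub _ (Or.inr h)).2 (P := fun v => ∀ u, (u, r, v) ∈ A.EW →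
    Relation.ReflTransGen (fun a b => (a, r, b) ∈ A.EW) ANode.bot v) ?_ u h
  intro v _ ih u h
  by_cases hu : u = ANode.bot
  · exact .single (hu ▸ h)
  · obtain ⟨w, hw⟩ := A.w_pred _ _ _ h hu
    exact (ih u (A.edges_sub _ (Or.inr h)).1 (.single ⟨r, Or.inr h⟩) w hw).tail h

/-- A target of an `r`-labeled write edge with no outgoing such edge is `last(r, E_W)`. -/
theorem AnnDAG.lastN_eq {R : Type} (A : AnnDAG R) {r : R} {u v : ANode}
    (h : (u, r, v) ∈ A.EW) (hv : ∀ w, (v, r, w) ∉ A.EW) : lastN A.EW r = v := by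
  have hreach := A.reflTransGen_bot h
  have huniq : ∃! x, Relation.ReflTransGen (fun a b => (a, r, b) ∈ A.EW) ANode.bot x ∧
      ∀ w, (x, r, w) ∉ A.EW := by
    refine ⟨v, ⟨hreach, hv⟩, fun x ⟨hx, hxend⟩ => ?_⟩
    rcases Relation.ReflTransGen.total_of_right_unique
      (fun a b c hab hac => A.w_out_unique a r b c hab hac) hx hreach with hxv | hvx
    · rcases hxv.cases_head with heq | ⟨w, hw, -⟩
      · exact heq
      · exact absurd hw (hxend w)
    · rcases hvx.cases_head with heq | ⟨w, hw, -⟩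
      · exact heq.symm
      · exact absurd hw (hv w)
  rw [lastN, dif_pos huniq]
  exact huniq.unique huniq.exists.choose_spec ⟨hreach, hv⟩

theorem node_maxpSucc_notMem {V : Set ANode} (hV : V.Finite) (p : PID) :
    ANode.node p (maxpSucc V p) ∉ V := by
  intro h
  have hfin : {m : ℕ | ∃ n, m = n + 1 ∧ ANode.node p n ∈ V}.Finite := by
    have hpre : {n : ℕ | ANode.node p n ∈ V}.Finite :=
      hV.preimage fun a _ b _ hab => (ANode.node.inj hab).2
    refine (hpre.image (· + 1)).subset ?_
    rintro m ⟨n, rfl, hn⟩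
    exact ⟨n, hn, rfl⟩
  have hle : maxpSucc V p + 1 ≤ maxpSucc V p := le_csSup hfin.bddAbove ⟨_, rfl, h⟩
  omega

theorem AnnDAG.loop_notMem {R : Type} (A : AnnDAG R) (r : R) (v : ANode) :
    (v, r, v) ∉ A.ER ∪ A.EW :=
  fun h => A.acyclic v (.single ⟨r, h⟩)

/-- The node added by a transition has no outgoing edges. -/
theorem Step.edge_notMem {R : Type} {A₁ A : AnnDAG R} {p : PID} {Rd Wt : Set R}
    (h : Step A₁ A p Rd Wt) (r : R) (w : ANode) :
    (ANode.node p (maxpSucc A₁.V p), r, w) ∉ A.ER ∪ A.EW := by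
  intro hmem
  have hnew := node_maxpSucc_notMem A₁.finV p
  have hloop := A.loop_notMem r (ANode.node p (maxpSucc A₁.V p))
  have hne : w ≠ ANode.node p (maxpSucc A₁.V p) := by
    rintro rfl
    exact hloop hmem
  obtain ⟨-, hER, hEW⟩ := h
  rw [hER, hEW] at hmem
  rcases hmem with (hold | ⟨_, -, heq⟩) | (hold | ⟨_, -, heq⟩)
  · exact hnew (A₁.edges_sub _ (Or.inl hold)).1
  · simp only [Prod.mk.injEq] at heq
    exact hne heq.2.2
  · exact hnew (A₁.edges_sub _ (Or.inr hold)).1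
  · simp only [Prod.mk.injEq] at heq
    exact hne heq.2.2

/-- If two transitions of distinct processes end at the same annotation DAG, then no resource
read by the first is written by the second. -/
theorem Step.read_inter_write_eq_empty {R : Type} {A A' A'' : AnnDAG R} {pa pb : PID}
    {Rda Wta Rdb Wtb : Set R}
    (ha : Step A' A pa Rda Wta) (hb : Step A'' A pb Rdb Wtb) (hne : pa ≠ pb) :
    Rda ∩ Wtb = ∅ := by
  rw [Set.eq_empty_iff_forall_notMem]
  rintro r ⟨hra, hrb⟩
  have hnew := hb.edge_notMem
  obtain ⟨-, hER, hEW⟩ := ha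
  have hwrite : (lastN A''.EW r, r, ANode.node pb (maxpSucc A''.V pb)) ∈ A.EW := by
    rw [hb.2.2]
    exact Or.inr ⟨r, hrb, rfl⟩
  have hwrite' : (lastN A''.EW r, r, ANode.node pb (maxpSucc A''.V pb)) ∈ A'.EW := by
    rw [hEW] at hwrite
    rcases hwrite with hold | ⟨_, -, heq⟩
    · exact hold
    · simp only [Prod.mk.injEq, ANode.node.injEq] at heq
      exact absurd heq.2.2.1.symm hne
  have hlast := A'.lastN_eq hwrite' fun w hw =>
    hnew r w (Or.inr (hEW ▸ Or.inl hw))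
  apply hnew r (ANode.node pa (maxpSucc A'.V pa))
  rw [← hlast, hER, hEW]
  by_cases hwa : r ∈ Wta
  · exact Or.inr (Or.inr ⟨r, hwa, rfl⟩)
  · exact Or.inl (Or.inr ⟨r, ⟨hra, hwa⟩, rfl⟩)

/-- two backward annotation transitions of distinct processes enabled
at the same annotation DAG have disjoint read/write sets. -/
theorem stmt10 {R : Type} {A A' A'' : AnnDAG R} {pa pb : PID}
    {Rda Wta Rdb Wtb : Set R}
    (h1 : Step A' A pa Rda Wta) (h2 : Step A'' A pb Rdb Wtb) (hne : pa ≠ pb) :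
    Rda ∩ Wtb = ∅ ∧ Rdb ∩ Wta = ∅ :=
  ⟨h1.read_inter_write_eq_empty h2 hne, h2.read_inter_write_eq_empty h1 hne.symm⟩

end CRIL
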